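/- For every integer t ≥ 1, the total domination number of the cubic Knödel graph W_{3,10t+6} equals 4t + 4. -/

import Mathlib

/-- The Knödel graph `W_{Δ,n}` (here `m = n/2`): a bipartite graph on the vertex set
`Bool × ZMod m`, where `(false, i)` plays the role of `u_i` and `(true, j)` the role of `v_j`,
and `u_i` is adjacent to `v_j` iff `j ≡ i + 2^k - 1 (mod m)` for some `0 ≤ k ≤ Δ - 1`. -/
def knodel (Δ m : ℕ) : SimpleGraph (Bool × ZMod m) :=
  SimpleGraph.fromRel (fun a b =>
    a.1 = false ∧ b.1 = true ∧ ∃ k < Δ, b.2 = a.2 + 2 ^ k - 1)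

/-- The total domination number of a graph `G`: the minimum cardinality of a (finite) set `D`
of vertices such that every vertex of `G` has a neighbor in `D`. -/
noncomputable def totalDominationNumber {V : Type*} (G : SimpleGraph V) : ℕ :=
  sInf {k | ∃ D : Set V, D.Finite ∧ D.ncard = k ∧ ∀ v, ∃ d ∈ D, G.Adj v d}

/-- Adjacency in `knodel 3 m` seen from a vertex `u_i`. -/
lemma knodel_three_adj_false {m : ℕ} (i : ZMod m) (d : Bool × ZMod m) :
    (knodel 3 m).Adj (false, i) d ↔
      d = (true, i) ∨ d = (true, i + 1) ∨ d = (true, i + 3) := by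
  obtain ⟨b, j⟩ := d
  have h : (∃ k < 3, j = i + 2 ^ k - 1) ↔ j = i ∨ j = i + 1 ∨ j = i + 3 := by
    have h1 : i + 2 ^ 1 - 1 = i + 1 := by ring
    have h2 : i + 2 ^ 2 - 1 = i + 3 := by ring
    simp only [Nat.exists_lt_succ_right, h1, h2]
    simp [or_assoc]
  cases b <;> simp [knodel, h]

/-- Adjacency in `knodel 3 m` seen from a vertex `v_j`. -/
lemma knodel_three_adj_true {m : ℕ} (j : ZMod m) (d : Bool × ZMod m) :
    (knodel 3 m).Adj (true, j) d ↔
      d = (false, j) ∨ d = (false, j - 1) ∨ d = (false, j - 3) := by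
  obtain ⟨b, i⟩ := d
  cases b
  · rw [SimpleGraph.adj_comm, knodel_three_adj_false]
    simp [eq_sub_iff_add_eq, eq_comm]
  · simp [knodel]

/-- A covering of `ZMod m` by translates of `{0, 1, 3}` has density at least `2 / 5`. -/
lemma two_mul_le_five_mul_card_of_cover {m : ℕ} [NeZero m] (S : Finset (ZMod m))
    (hS : ∀ x, x ∈ S ∨ x - 1 ∈ S ∨ x - 3 ∈ S) : 2 * m ≤ 5 * S.card := by
  classical
  let f : ZMod m → ℤ := fun x => if x ∈ S then 1 else 0
  -- `g₁`, `g₂`, `g₃` indicate that the gap following `x ∈ S` is at least `2`, `3`, `4`.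
  let g₁ : ZMod m → ℤ := fun x => f x * (1 - f (x + 1))
  let g₂ : ZMod m → ℤ := fun x => g₁ x * (1 - f (x + 2))
  let g₃ : ZMod m → ℤ := fun x => g₂ x * (1 - f (x + 3))
  have shift (g : ZMod m → ℤ) (c : ZMod m) : ∑ x, g (x - c) = ∑ x, g x :=
    Equiv.sum_comp (Equiv.subRight c) g
  have f01 (x) : f x = 0 ∨ f x = 1 := by
    by_cases h : x ∈ S <;> simp [f, h]
  have cover (x) : f x = 1 ∨ f (x - 1) = 1 ∨ f (x - 3) = 1 := by
    simpa [f] using hS x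
  have gap_le (x) : 1 ≤ f x + g₁ (x - 1) + g₂ (x - 2) + g₃ (x - 3) := by
    have e1 : x - 1 + 1 = x := by ring
    have e2 : x - 2 + 1 = x - 1 := by ring
    have e3 : x - 2 + 2 = x := by ring
    have e4 : x - 3 + 1 = x - 2 := by ring
    have e5 : x - 3 + 2 = x - 1 := by ring
    have e6 : x - 3 + 3 = x := by ring
    simp only [g₁, g₂, g₃, e1, e2, e3, e4, e5, e6]
    rcases f01 x with h | h <;> rcases f01 (x - 1) with h1 | h1 <;>
      rcases f01 (x - 2) with h2 | h2 <;> rcases f01 (x - 3) with h3 | h3 <;>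
      have := cover x <;> simp_all
  have long_gap (x) : g₁ (x - 1) + g₂ x ≤ f (x - 1) := by
    have e1 : x - 1 + 1 = x := by ring
    have e2 : x + 2 - 1 = x + 1 := by ring
    have e3 : x + 2 - 3 = x - 1 := by ring
    have c := cover (x + 2)
    rw [e2, e3] at c
    simp only [g₁, g₂, e1]
    rcases f01 x with h | h <;> rcases f01 (x - 1) with h1 | h1 <;>
      rcases f01 (x + 1) with h2 | h2 <;> rcases f01 (x + 2) with h3 | h3 <;>
      simp_all
  have g₂_le (x) : g₂ x ≤ g₁ x := by
    simp only [g₁, g₂]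
    rcases f01 x with h | h <;> rcases f01 (x + 1) with h1 | h1 <;>
      rcases f01 (x + 2) with h2 | h2 <;> simp [h, h1, h2]
  have g₃_le (x) : g₃ x ≤ g₂ x := by
    simp only [g₁, g₂, g₃]
    rcases f01 x with h | h <;> rcases f01 (x + 1) with h1 | h1 <;>
      rcases f01 (x + 2) with h2 | h2 <;> rcases f01 (x + 3) with h3 | h3 <;>
      simp [h, h1, h2, h3]
  have s1 := Finset.sum_le_sum fun x (_ : x ∈ Finset.univ) => gap_le x
  have s2 := Finset.sum_le_sum fun x (_ : x ∈ Finset.univ) => long_gap x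
  have s3 := Finset.sum_le_sum fun x (_ : x ∈ Finset.univ) => g₂_le x
  have s4 := Finset.sum_le_sum fun x (_ : x ∈ Finset.univ) => g₃_le x
  simp only [Finset.sum_add_distrib, shift] at s1 s2
  have card_univ : ∑ _x : ZMod m, (1 : ℤ) = m := by simp [ZMod.card]
  have card_S : ∑ x, f x = S.card := by simp [f]
  omega

/-- The blocks `{5k, 5k + 1}` with `k ≤ t` give a covering of `ZMod (5t + 3)`. -/
lemma exists_block_cover (t : ℕ) (x : ZMod (5 * t + 3)) :
    ∃ k : Fin (t + 1), ∃ b : Fin 2, ∃ c : ZMod (5 * t + 3), (c = 0 ∨ c = 1 ∨ c = 3) ∧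
      x = ((5 * k.val + b.val : ℕ) : ZMod (5 * t + 3)) + c := by
  obtain ⟨n, hn, rfl⟩ : ∃ n < 5 * t + 3, (n : ZMod (5 * t + 3)) = x :=
    ⟨x.val, ZMod.val_lt x, ZMod.natCast_zmod_val x⟩
  have hk : n / 5 < t + 1 := by omega
  obtain ⟨b, c, hc, h⟩ : ∃ b : Fin 2, ∃ c : ℕ, (c = 0 ∨ c = 1 ∨ c = 3) ∧
      n = 5 * (n / 5) + b.val + c := by
    have h5 : n % 5 = 0 ∨ n % 5 = 1 ∨ n % 5 = 2 ∨ n % 5 = 3 ∨ n % 5 = 4 := by omega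
    rcases h5 with h | h | h | h | h
    · exact ⟨0, 0, by simp, by simp; omega⟩
    · exact ⟨1, 0, by simp, by simp; omega⟩
    · exact ⟨1, 1, by simp, by simp; omega⟩
    · exact ⟨0, 3, by simp, by simp; omega⟩
    · exact ⟨1, 3, by simp, by simp; omega⟩
  refine ⟨⟨n / 5, hk⟩, b, c, ?_, ?_⟩
  · rcases hc with rfl | rfl | rfl <;> simp
  · rw [← Nat.cast_add, ← h]

lemma exists_total_dominating_set (t : ℕ) :
    ∃ D : Set (Bool × ZMod (5 * t + 3)), D.Finite ∧ D.ncard ≤ 4 * t + 4 ∧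
      ∀ v, ∃ d ∈ D, (knodel 3 (5 * t + 3)).Adj v d := by
  let φ : Bool × Fin (t + 1) × Fin 2 → Bool × ZMod (5 * t + 3) := fun p =>
    (p.1, (if p.1 then -1 else 1) * ((5 * p.2.1.val + p.2.2.val : ℕ) : ZMod (5 * t + 3)))
  refine ⟨Set.range φ, Set.finite_range φ, ?_, ?_⟩
  · rw [← Set.image_univ]
    refine (Set.ncard_image_le Set.finite_univ).trans ?_
    simp only [Set.ncard_univ, Nat.card_eq_fintype_card, Fintype.card_prod, Fintype.card_bool,
      Fintype.card_fin]
    omega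
  · rintro ⟨_ | _, x⟩
    · obtain ⟨k, b, c, hc, hx⟩ := exists_block_cover t (-x)
      refine ⟨φ (true, k, b), ⟨_, rfl⟩, (knodel_three_adj_false _ _).2 ?_⟩
      have h : φ (true, k, b) = (true, x + c) := by
        simp only [φ, if_true, Prod.mk.injEq, true_and]
        linear_combination hx
      rw [h]
      rcases hc with rfl | rfl | rfl <;> simp
    · obtain ⟨k, b, c, hc, hx⟩ := exists_block_cover t x
      refine ⟨φ (false, k, b), ⟨_, rfl⟩, (knodel_three_adj_true _ _).2 ?_⟩
      have h : φ (false, k, b) = (false, x - c) := by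
        simp only [φ, Bool.false_eq_true, if_false, Prod.mk.injEq, true_and]
        linear_combination -hx
      rw [h]
      rcases hc with rfl | rfl | rfl <;> simp

lemma le_ncard_of_total_dominating (t : ℕ) (D : Set (Bool × ZMod (5 * t + 3)))
    (hD : ∀ v, ∃ d ∈ D, (knodel 3 (5 * t + 3)).Adj v d) : 4 * t + 4 ≤ D.ncard := by
  classical
  let A : Finset (ZMod (5 * t + 3)) := {x | (false, x) ∈ D}
  let B : Finset (ZMod (5 * t + 3)) := {x | (true, -x) ∈ D}
  have hA := two_mul_le_five_mul_card_of_cover A fun x => by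
    obtain ⟨d, hd, h⟩ := hD (true, x)
    rcases (knodel_three_adj_true _ _).1 h with rfl | rfl | rfl <;> simp [A, hd]
  have hB := two_mul_le_five_mul_card_of_cover B fun x => by
    obtain ⟨d, hd, h⟩ := hD (false, -x)
    rcases (knodel_three_adj_false _ _).1 h with rfl | rfl | rfl <;>
      simp_all [B, neg_add_eq_sub]
  have hAB : (A.disjSum B).card ≤ D.ncard := by
    rw [Set.ncard_eq_toFinset_card']
    refine Finset.card_le_card_of_injOn
      (Sum.elim (fun x => (false, x)) fun x => (true, -x)) ?_ ?_
    · rintro (x | x) hx <;> simpa [A, B] using hx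
    · rintro (x | x) _ (y | y) _ h <;> simp_all
  rw [Finset.card_disjSum] at hAB
  omega

/-- Case 4: for every `t ≥ 1`, the total domination number of `W_{3,10t+6}` equals `4t + 4`. -/
theorem knodel_stmt_16 (t : ℕ) (ht : 1 ≤ t) :
    totalDominationNumber (knodel 3 ((10 * t + 6) / 2)) = 4 * t + 4 := by
  rw [show (10 * t + 6) / 2 = 5 * t + 3 by omega]
  obtain ⟨D, hfin, hcard, hD⟩ := exists_total_dominating_set t
  refine le_antisymm (le_trans (Nat.sInf_le ?_) hcard) ?_
  · exact ⟨D, hfin, rfl, hD⟩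
  refine le_csInf ⟨D.ncard, D, hfin, rfl, hD⟩ ?_
  rintro _ ⟨E, -, rfl, hE⟩
  exact le_ncard_of_total_dominating t E hE
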